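/- Conservativity propagates from even to odd rows (part of Theorem 5.2): for every n ≥ 1 and q̃ = (q_1,…,q_{n+1}) ∈ (0,1)^{n+1}, writing q = (q_1,…,q_n), if Σ_{x′ ∈ W_0^n} Q_{2n}(x,x′) = 0 for every x ∈ W_0^n (Q_{2n} built from q), then Σ_{y′ ∈ W_0^{n+1}} Q_{2n+1}(y,y′) = 0 for every y ∈ W_0^{n+1} (Q_{2n+1} built from q̃). (Each row has finitely many nonzero entries, so these sums are finite.) -/

import Mathlib

open scoped BigOperators

noncomputable section

/-- Sum of the entries of an integer vector. -/
def vsum {n : ℕ} (z : Fin n → ℤ) : ℤ := ∑ i, z i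

/-- `Interlace x y` means `x ⪯ y`, i.e. `y_i ≤ x_i ≤ y_{i+1}` for `1 ≤ i ≤ n`. -/
def Interlace {n : ℕ} (x : Fin n → ℤ) (y : Fin (n + 1) → ℤ) : Prop :=
  ∀ i : Fin n, y i.castSucc ≤ x i ∧ x i ≤ y i.succ

/-- `PrecEq x x'` means `x ≺ x'`: `x_1 ≤ x'_1 ≤ x_2 ≤ x'_2 ≤ … ≤ x_k ≤ x'_k`. -/
def PrecEq {k : ℕ} (x x' : Fin k → ℤ) : Prop :=
  (∀ i, x i ≤ x' i) ∧ ∀ (i : ℕ) (h : i + 1 < k), x' ⟨i, Nat.lt_of_succ_lt h⟩ ≤ x ⟨i + 1, h⟩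

/-- Membership in `W₀^k = {0 ≤ z_1 ≤ z_2 ≤ ⋯ ≤ z_k}`. -/
def W0 {k : ℕ} (z : Fin k → ℤ) : Prop := Monotone z ∧ ∀ i, 0 ≤ z i

/-- `p` encodes an integer symplectic Gelfand–Tsetlin pattern with rows `1, …, n`,
row `r` having `⌈r/2⌉ = (r+1)/2` nonnegative entries `p r 0, …`; consecutive rows
satisfy `x^{2i-1} ≺ x^{2i}` and `x^{2i} ⪯ x^{2i+1}`; irrelevant entries are pinned to `0`. -/
def IsSymp (n : ℕ) (p : ℕ → ℕ → ℤ) : Prop :=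
  (∀ r i, 1 ≤ r → r ≤ n → i < (r + 1) / 2 → 0 ≤ p r i) ∧
  (∀ k, 1 ≤ k → 2 * k ≤ n →
    (∀ j, j < k → p (2 * k - 1) j ≤ p (2 * k) j) ∧
    (∀ j, j + 1 < k → p (2 * k) j ≤ p (2 * k - 1) (j + 1))) ∧
  (∀ k, 1 ≤ k → 2 * k + 1 ≤ n →
    (∀ j, j < k → p (2 * k + 1) j ≤ p (2 * k) j ∧ p (2 * k) j ≤ p (2 * k + 1) (j + 1))) ∧
  (∀ r i, r = 0 ∨ n < r ∨ (r + 1) / 2 ≤ i → p r i = 0)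

/-- `|x^r|`, the sum of the entries of row `r` (row `r` has `(r+1)/2` entries). -/
def rowSumS (p : ℕ → ℕ → ℤ) (r : ℕ) : ℤ := ∑ i ∈ Finset.range ((r + 1) / 2), p r i

/-- The geometric weight `w^q_n(x)`: each row `r` contributes
`q_{⌈r/2⌉}^{|x^r|−|x^{r−1}|}` if `r` is odd and `q_{r/2}^{−(|x^r|−|x^{r−1}|)}` if `r`
is even, which reproduces `w^q_{2k−1}` and `w^q_{2k}` (0-based rates). -/
def wSymp (n : ℕ) (q : ℕ → ℝ) (p : ℕ → ℕ → ℤ) : ℝ :=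
  ∏ r ∈ Finset.Icc 1 n,
    q ((r + 1) / 2 - 1) ^ ((if r % 2 = 1 then (1 : ℤ) else -1) * (rowSumS p r - rowSumS p (r - 1)))

/-- The symplectic Schur function `Sp^{2k−1}_z(q_1,…,q_k)`. -/
def SpOdd (k : ℕ) (q : ℕ → ℝ) (z : Fin k → ℤ) : ℝ :=
  ∑ᶠ p ∈ {p : ℕ → ℕ → ℤ | IsSymp (2 * k - 1) p ∧ ∀ i : Fin k, p (2 * k - 1) i = z i},
    wSymp (2 * k - 1) q p

/-- The symplectic Schur function `Sp^{2k}_z(q_1,…,q_k)`. -/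
def SpEven (k : ℕ) (q : ℕ → ℝ) (z : Fin k → ℤ) : ℝ :=
  ∑ᶠ p ∈ {p : ℕ → ℕ → ℤ | IsSymp (2 * k) p ∧ ∀ i : Fin k, p (2 * k) i = z i},
    wSymp (2 * k) q p

open Classical in
/-- The `Q`-matrix `Q_{2k−1}` on `W₀^k` (here `k = m+1`): jumps `x → x ± e_i` at rate
`Sp^{2k−1}_{x±e_i}(q)/Sp^{2k−1}_x(q)` whenever `x ± e_i ∈ W₀^k`, with diagonal
`−[Σ_{i=1}^{k−1}(q_i+q_i^{−1}) + q_k^{−1}·1{x_1>0} + q_k]`. -/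
def Qodd (m : ℕ) (q : ℕ → ℝ) (x x' : Fin (m + 1) → ℤ) : ℝ :=
  if x' = x then
    -((∑ i ∈ Finset.range m, (q i + (q i)⁻¹)) +
      (q m)⁻¹ * (if 0 < x 0 then 1 else 0) + q m)
  else if (∃ i, x' = x + Pi.single i 1 ∨ x' = x - Pi.single i 1) ∧ W0 x' then
    SpOdd (m + 1) q x' / SpOdd (m + 1) q x
  else 0

open Classical in
/-- The `Q`-matrix `Q_{2k}` on `W₀^k` (here `k = m+1`): jumps `x → x ± e_i` at rate
`Sp^{2k}_{x±e_i}(q)/Sp^{2k}_x(q)` whenever `x ± e_i ∈ W₀^k`, with diagonal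
`−Σ_{i=1}^{k}(q_i+q_i^{−1})`. -/
def Qeven (m : ℕ) (q : ℕ → ℝ) (x x' : Fin (m + 1) → ℤ) : ℝ :=
  if x' = x then -(∑ i ∈ Finset.range (m + 1), (q i + (q i)⁻¹))
  else if (∃ i, x' = x + Pi.single i 1 ∨ x' = x - Pi.single i 1) ∧ W0 x' then
    SpEven (m + 1) q x' / SpEven (m + 1) q x
  else 0

/-- Indicator of `x ⪯ z` with `z` nonnegative at its first entry. -/
def interlaceInd {n : ℕ} (x : Fin n → ℤ) (z : Fin (n + 1) → ℤ) : ℝ :=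
  open Classical in if Interlace x z ∧ 0 ≤ z 0 then 1 else 0

lemma finite_interlace {n : ℕ} (z : Fin (n + 1) → ℤ) : {x : Fin n → ℤ | Interlace x z}.Finite :=
  (Set.finite_Icc (fun i : Fin n => z i.castSucc) (fun i => z i.succ)).subset
    fun _ hx => ⟨fun i => (hx i).1, fun i => (hx i).2⟩

lemma hasFiniteSupport_mul_interlaceInd {n : ℕ} (g : (Fin n → ℤ) → ℝ) (z : Fin (n + 1) → ℤ) :
    Function.HasFiniteSupport fun x => g x * interlaceInd x z := by
  refine (finite_interlace z).subset fun x hx => ?_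
  by_contra hn
  have hn' : ¬ Interlace x z := hn
  exact hx (by simp [interlaceInd, hn'])

lemma hasFiniteSupport_mul_interlaceInd_sub {n : ℕ} (g : (Fin n → ℤ) → ℝ)
    (z : Fin (n + 1) → ℤ) (v : Fin n → ℤ) :
    Function.HasFiniteSupport fun x => g x * interlaceInd (x - v) z := by
  refine ((finite_interlace z).preimage (sub_left_injective (b := v)).injOn).subset
    fun x hx => ?_
  by_contra hn
  have hn' : ¬ Interlace (x - v) z := hn
  exact hx (by simp [interlaceInd, hn'])

lemma Interlace.w0_iff {n : ℕ} {x : Fin n → ℤ} {z : Fin (n + 1) → ℤ} (h : Interlace x z) :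
    W0 z ↔ 0 ≤ z 0 := by
  refine ⟨fun hz => hz.2 0, fun h0 => ?_⟩
  have hm : Monotone z := Fin.monotone_iff_le_succ.2 fun i => (h i).1.trans (h i).2
  exact ⟨hm, fun i => h0.trans (hm (Fin.zero_le i))⟩

lemma Interlace.w0 {n : ℕ} {x : Fin n → ℤ} {z : Fin (n + 1) → ℤ} (h : Interlace x z)
    (hz : W0 z) : W0 x := by
  refine ⟨?_, fun i => (hz.2 _).trans (h i).1⟩
  cases n with
  | zero => exact fun i => i.elim0
  | succ n =>
    exact Fin.monotone_iff_le_succ.2 fun i => (h _).2.trans (by simpa using (h i.succ).1)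

lemma vsum_add_single {n : ℕ} (x : Fin n → ℤ) (i : Fin n) (c : ℤ) :
    vsum (x + Pi.single i c) = vsum x + c := by
  simp [vsum, Finset.sum_add_distrib]

lemma vsum_sub_single {n : ℕ} (x : Fin n → ℤ) (i : Fin n) (c : ℤ) :
    vsum (x - Pi.single i c) = vsum x - c := by
  simp [vsum, Finset.sum_sub_distrib]

lemma interlaceInd_congr {n : ℕ} {x x' : Fin n → ℤ} {z z' : Fin (n + 1) → ℤ}
    (h : Interlace x z ∧ 0 ≤ z 0 ↔ Interlace x' z' ∧ 0 ≤ z' 0) :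
    interlaceInd x z = interlaceInd x' z' := by
  unfold interlaceInd
  by_cases hx : Interlace x z ∧ 0 ≤ z 0
  · rw [if_pos hx, if_pos (h.1 hx)]
  · rw [if_neg hx, if_neg (mt h.2 hx)]

lemma interlaceInd_of_not {n : ℕ} {x : Fin n → ℤ} {z : Fin (n + 1) → ℤ} (h : ¬ Interlace x z) :
    interlaceInd x z = 0 := if_neg fun h' => h h'.1

section SingleSteps

variable {n : ℕ} {x : Fin n → ℤ} {y : Fin (n + 1) → ℤ}

lemma Interlace.add_single_castSucc_iff (h : Interlace x y) (i : Fin n) :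
    Interlace x (y + Pi.single i.castSucc 1) ↔ y i.castSucc + 1 ≤ x i := by
  refine ⟨fun h' => by simpa using (h' i).1, fun h' k => ?_⟩
  have := h k
  simp only [Pi.add_apply, Pi.single_apply, Fin.castSucc_inj]
  constructor
  · split_ifs with hk
    · subst hk; omega
    · omega
  · split_ifs <;> omega

lemma Interlace.sub_single_left_iff (h : Interlace x y) (i : Fin n) :
    Interlace (x - Pi.single i 1) y ↔ y i.castSucc + 1 ≤ x i := by
  refine ⟨fun h' => by simpa [le_sub_iff_add_le] using (h' i).1, fun h' k => ?_⟩
  have := h k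
  simp only [Pi.sub_apply, Pi.single_apply]
  split_ifs with hk
  · subst hk; omega
  · omega

lemma Interlace.add_single_last (h : Interlace x y) :
    Interlace x (y + Pi.single (Fin.last n) 1) := fun k => by
  have := h k
  have hk : k.castSucc ≠ Fin.last n := (Fin.castSucc_lt_last k).ne
  simp only [Pi.add_apply, Pi.single_apply, hk, if_false]
  split_ifs <;> omega

lemma Interlace.of_add_single_zero (h : Interlace x (y + Pi.single 0 1)) : Interlace x y :=
  fun k => by
    have := h k
    simp only [Pi.add_apply, Pi.single_apply, Fin.succ_ne_zero, if_false] at this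
    split_ifs at this <;> omega

lemma interlace_add_single_succ_iff (hx : Monotone x) (hy : Monotone y) (h : ¬ Interlace x y)
    (i : Fin n) :
    Interlace x (y + Pi.single i.succ 1) ↔ Interlace (x - Pi.single i 1) y := by
  simp only [Interlace, Pi.add_apply, Pi.sub_apply, Pi.single_apply, Fin.succ_inj] at h ⊢
  push Not at h
  obtain ⟨k₀, h₀⟩ := h
  constructor
  · intro h' k
    have hk := h' k
    have hk₀ := h' k₀
    have hki : k₀ = i := by
      by_contra hne
      rw [if_neg hne] at hk₀
      split_ifs at hk₀ <;> omega
    subst hki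
    have := hy (Fin.castSucc_lt_succ (i := k)).le
    have h1 : y k₀.castSucc ≤ x k₀ := by
      have := hk₀.1
      split_ifs at this <;> omega
    have := h₀ h1
    by_cases hkk : k = k₀
    · subst hkk
      simp only [if_true] at *
      omega
    · simp only [hkk, if_false] at *
      split_ifs at hk <;> omega
  · intro h' k
    have hk := h' k
    have hk₀ := h' k₀
    have hki : k₀ = i := by
      by_contra hne
      rw [if_neg hne] at hk₀
      omega
    subst hki
    simp only [if_true] at hk₀
    have := h₀ (by omega)
    refine ⟨?_, by split_ifs at hk ⊢ <;> omega⟩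
    by_cases hkk : k.castSucc = k₀.succ
    · rw [if_pos hkk, hkk]
      have : x k₀ ≤ x k := hx (by
        have := congrArg Fin.val hkk
        simp only [Fin.val_castSucc, Fin.val_succ] at this
        exact Fin.le_def.2 (by omega))
      omega
    · rw [if_neg hkk]
      split_ifs at hk <;> omega

lemma Interlace.sub_single_succ_iff (h : Interlace x y) (i : Fin n) :
    Interlace x (y - Pi.single i.succ 1) ↔ x i + 1 ≤ y i.succ := by
  refine ⟨fun h' => by simpa [le_sub_iff_add_le] using (h' i).2, fun h' k => ?_⟩
  have := h k
  simp only [Pi.sub_apply, Pi.single_apply, Fin.succ_inj]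
  constructor
  · split_ifs <;> omega
  · split_ifs with hk
    · subst hk; omega
    · omega

lemma Interlace.add_single_left_iff (h : Interlace x y) (i : Fin n) :
    Interlace (x + Pi.single i 1) y ↔ x i + 1 ≤ y i.succ := by
  refine ⟨fun h' => by simpa using (h' i).2, fun h' k => ?_⟩
  have := h k
  simp only [Pi.add_apply, Pi.single_apply]
  split_ifs with hk
  · subst hk; omega
  · omega

lemma Interlace.sub_single_zero (h : Interlace x y) : Interlace x (y - Pi.single 0 1) :=
  fun k => by
    have := h k
    simp only [Pi.sub_apply, Pi.single_apply, Fin.succ_ne_zero, if_false]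
    split_ifs <;> omega

lemma Interlace.of_sub_single_last (h : Interlace x (y - Pi.single (Fin.last n) 1)) :
    Interlace x y := fun k => by
  have := h k
  have hk : k.castSucc ≠ Fin.last n := (Fin.castSucc_lt_last k).ne
  simp only [Pi.sub_apply, Pi.single_apply, hk, if_false] at this
  split_ifs at this <;> omega

lemma interlace_sub_single_castSucc_iff (hx : W0 x) (hy : W0 y) (h : ¬ Interlace x y)
    (i : Fin n) :
    Interlace x (y - Pi.single i.castSucc 1) ∧
        0 ≤ (y - Pi.single i.castSucc 1 : Fin (n + 1) → ℤ) 0 ↔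
      Interlace (x + Pi.single i 1) y := by
  simp only [Interlace, Pi.add_apply, Pi.sub_apply, Pi.single_apply, Fin.castSucc_inj] at h ⊢
  push Not at h
  obtain ⟨k₀, h₀⟩ := h
  constructor
  · rintro ⟨h', -⟩ k
    have hk := h' k
    have hk₀ := h' k₀
    have hki : k₀ = i := by
      by_contra hne
      rw [if_neg hne] at hk₀
      split_ifs at hk₀ <;> omega
    subst hki
    have := hy.1 (Fin.castSucc_lt_succ (i := k)).le
    have h1 : x k₀ < y k₀.castSucc := by
      by_contra hlt
      have := h₀ (by omega)
      split_ifs at hk₀ <;> omega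
    by_cases hkk : k = k₀
    · subst hkk
      simp only [if_true] at *
      omega
    · simp only [hkk, if_false] at *
      split_ifs at hk <;> omega
  · intro h'
    have hk₀ := h' k₀
    have hki : k₀ = i := by
      by_contra hne
      rw [if_neg hne] at hk₀
      omega
    subst hki
    simp only [if_true] at hk₀
    have h1 : x k₀ < y k₀.castSucc := by
      by_contra hlt
      have := h₀ (by omega)
      omega
    refine ⟨fun k => ?_, ?_⟩
    · have hk := h' k
      refine ⟨by split_ifs at hk ⊢ <;> omega, ?_⟩
      by_cases hkk : k.succ = k₀.castSucc
      · rw [if_pos hkk, hkk]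
        have : x k ≤ x k₀ := hx.1 (by
          have := congrArg Fin.val hkk
          simp only [Fin.val_castSucc, Fin.val_succ] at this
          exact Fin.le_def.2 (by omega))
        omega
      · rw [if_neg hkk]
        split_ifs at hk <;> omega
    · have := hy.2 0
      have := hx.2 k₀
      split_ifs with h0
      · rw [h0]; omega
      · omega

/-- Raising one entry of the upper row against lowering one entry of the lower row. -/
lemma sum_interlaceInd_add_single (hx : W0 x) (hy : W0 y) :
    ∑ j, interlaceInd x (y + Pi.single j 1) =
      ∑ i, interlaceInd (x - Pi.single i 1) y + interlaceInd x y := by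
  have h0 : 0 ≤ y 0 := hy.2 0
  have h1 : ∀ j, 0 ≤ (y + Pi.single j 1 : Fin (n + 1) → ℤ) 0 := fun j => by
    simp only [Pi.add_apply, Pi.single_apply]
    split_ifs <;> omega
  by_cases h : Interlace x y
  · rw [Fin.sum_univ_castSucc]
    congr 1
    · refine Finset.sum_congr rfl fun i _ => interlaceInd_congr ?_
      simp only [h0, h1, and_true, h.add_single_castSucc_iff, h.sub_single_left_iff]
    · exact interlaceInd_congr (by simp only [h0, h1, and_true, h, h.add_single_last])
  · rw [Fin.sum_univ_succ, interlaceInd_of_not h,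
      interlaceInd_of_not (mt Interlace.of_add_single_zero h), zero_add, add_zero]
    refine Finset.sum_congr rfl fun i _ => interlaceInd_congr ?_
    simp only [h0, h1, and_true, interlace_add_single_succ_iff hx.1 hy.1 h]

/-- Lowering one entry of the upper row against raising one entry of the lower row. -/
lemma sum_interlaceInd_sub_single (hx : W0 x) (hy : W0 y) :
    ∑ j, interlaceInd x (y - Pi.single j 1) =
      ∑ i, interlaceInd (x + Pi.single i 1) y + (if 0 < y 0 then 1 else 0) * interlaceInd x y := by
  have h0 : 0 ≤ y 0 := hy.2 0
  by_cases h : Interlace x y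
  · rw [Fin.sum_univ_succ, add_comm]
    congr 1
    · refine Finset.sum_congr rfl fun i _ => interlaceInd_congr ?_
      have h1 : 0 ≤ (y - Pi.single i.succ 1 : Fin (n + 1) → ℤ) 0 := by
        simpa [Pi.single_apply, (Fin.succ_ne_zero i).symm] using h0
      simp only [h0, h1, and_true, h.sub_single_succ_iff, h.add_single_left_iff]
    · simp only [interlaceInd, h, h.sub_single_zero, h0, true_and, and_self, if_true, mul_one,
        Pi.sub_apply, Pi.single_eq_same]
      exact if_congr (by omega) rfl rfl
  · rw [Fin.sum_univ_castSucc, interlaceInd_of_not h,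
      interlaceInd_of_not (mt Interlace.of_sub_single_last h), mul_zero]
    congr 1
    refine Finset.sum_congr rfl fun i _ => interlaceInd_congr ?_
    rw [interlace_sub_single_castSucc_iff hx hy h, and_iff_left h0]

end SingleSteps

/-- Sum of `S x * a ^ (|z| - |x|)` over the rows `x` interlacing a nonnegative row `z`. -/
def interlaceSum {n : ℕ} (a : ℝ) (S : (Fin n → ℤ) → ℝ) (z : Fin (n + 1) → ℤ) : ℝ :=
  ∑ᶠ x : Fin n → ℤ, S x * a ^ (vsum z - vsum x) * interlaceInd x z

lemma interlaceSum_of_not_w0 {n : ℕ} (a : ℝ) (S : (Fin n → ℤ) → ℝ) {z : Fin (n + 1) → ℤ}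
    (hz : ¬ W0 z) : interlaceSum a S z = 0 := by
  refine finsum_eq_zero_of_forall_eq_zero fun x => ?_
  have : interlaceInd x z = 0 := if_neg fun h => hz (h.1.w0_iff.2 h.2)
  rw [this, mul_zero]

section Intertwining

variable {n : ℕ} {a : ℝ} {S : (Fin n → ℤ) → ℝ} {y : Fin (n + 1) → ℤ}

lemma sum_interlaceSum_add_single (ha : a ≠ 0) (hS : ∀ x, ¬ W0 x → S x = 0) (ε : ℤ) (t : ℝ)
    (hsum : ∀ x, W0 x → ∑ j, interlaceInd x (y + Pi.single j ε) =
      ∑ i, interlaceInd (x - Pi.single i ε) y + t * interlaceInd x y) :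
    ∑ j, interlaceSum a S (y + Pi.single j ε) =
      ∑ᶠ x : Fin n → ℤ, (∑ i, S (x + Pi.single i ε)) * a ^ (vsum y - vsum x) * interlaceInd x y +
        t * a ^ ε * interlaceSum a S y := by
  have key : ∀ x, ∑ j, S x * a ^ (vsum (y + Pi.single j ε) - vsum x) *
        interlaceInd x (y + Pi.single j ε) =
      ∑ i, S x * a ^ (vsum y - vsum (x - Pi.single i ε)) * interlaceInd (x - Pi.single i ε) y +
        t * a ^ ε * (S x * a ^ (vsum y - vsum x) * interlaceInd x y) := fun x => by
    by_cases hx : W0 x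
    · simp only [vsum_add_single, vsum_sub_single, ← Finset.mul_sum, add_sub_right_comm,
        ← sub_add, hsum x hx, zpow_add₀ ha]
      ring
    · simp [hS x hx]
  unfold interlaceSum
  rw [← finsum_sum_comm _ _ fun j _ => hasFiniteSupport_mul_interlaceInd _ _,
    finsum_congr key, finsum_add_distrib, ← mul_finsum,
    finsum_sum_comm _ _ fun j _ => hasFiniteSupport_mul_interlaceInd_sub _ _ _]
  · congr 1
    simp only [Finset.sum_mul]
    rw [finsum_sum_comm _ _ fun j _ => hasFiniteSupport_mul_interlaceInd _ _]
    refine Finset.sum_congr rfl fun i _ => ?_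
    rw [← finsum_comp_equiv (Equiv.addRight (Pi.single i ε))]
    simp
  · exact Function.HasFiniteSupport.sum
      (fun i => hasFiniteSupport_mul_interlaceInd_sub _ _ _) Finset.univ
  · simp only [← mul_assoc]
    exact hasFiniteSupport_mul_interlaceInd _ _

/-- `interlaceSum` turns an eigenfunction of the sum of all unit steps into an eigenfunction of
the same operator one dimension higher, up to a boundary term at the wall. -/
theorem interlaceSum_eigen (ha : a ≠ 0) (hS : ∀ x, ¬ W0 x → S x = 0) {c : ℝ}
    (hc : ∀ x, W0 x → ∑ i, S (x + Pi.single i 1) + ∑ i, S (x - Pi.single i 1) = c * S x)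
    (hy : W0 y) :
    ∑ j, interlaceSum a S (y + Pi.single j 1) + ∑ j, interlaceSum a S (y - Pi.single j 1) =
      (c + a⁻¹ * (if 0 < y 0 then 1 else 0) + a) * interlaceSum a S y := by
  have hup := sum_interlaceSum_add_single (y := y) ha hS 1 1 fun x hx => by
    rw [sum_interlaceInd_add_single hx hy, one_mul]
  have hdown := sum_interlaceSum_add_single (y := y) ha hS (-1) (if 0 < y 0 then 1 else 0)
    fun x hx => by
      simpa [Pi.single_neg, ← sub_eq_add_neg] using sum_interlaceInd_sub_single hx hy
  simp only [Pi.single_neg, ← sub_eq_add_neg] at hdown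
  have hmain : c * interlaceSum a S y =
      ∑ᶠ x, (∑ i, S (x + Pi.single i 1)) * a ^ (vsum y - vsum x) * interlaceInd x y +
      ∑ᶠ x, (∑ i, S (x - Pi.single i 1)) * a ^ (vsum y - vsum x) * interlaceInd x y := by
    unfold interlaceSum
    rw [← finsum_add_distrib (hasFiniteSupport_mul_interlaceInd _ _)
      (hasFiniteSupport_mul_interlaceInd _ _), mul_finsum]
    refine finsum_congr fun x => ?_
    by_cases hx : Interlace x y
    · rw [← add_mul, ← add_mul, hc x (hx.w0 hy)]
      ring
    · simp [interlaceInd_of_not hx]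
  rw [hup, hdown, zpow_neg_one, zpow_one]
  linear_combination -hmain

end Intertwining

lemma finsum_mem_w0_step {k : ℕ} (Q : (Fin k → ℤ) → ℝ) (f : (Fin k → ℤ) → ℝ) (x : Fin k → ℤ)
    (hx : W0 x) (hf : ∀ z, ¬ W0 z → f z = 0)
    (hQ : ∀ x', x' ≠ x → W0 x' →
      (∃ i, x' = x + Pi.single i 1 ∨ x' = x - Pi.single i 1) → Q x' = f x')
    (hQ0 : ∀ x', x' ≠ x →
      ¬ (∃ i, x' = x + Pi.single i 1 ∨ x' = x - Pi.single i 1) → Q x' = 0) :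
    ∑ᶠ x' ∈ {x' | W0 x'}, Q x' =
      Q x + ∑ i, f (x + Pi.single i 1) + ∑ i, f (x - Pi.single i 1) := by
  classical
  have hadd : ∀ i, x + Pi.single i 1 ≠ x := fun i hi => by simpa using congrFun hi i
  have hsub : ∀ i, x - Pi.single i 1 ≠ x := fun i hi => by simpa using congrFun hi i
  have hinj : Function.Injective fun i : Fin k => (Pi.single i 1 : Fin k → ℤ) := fun i j hij => by
    by_contra hne
    simpa [Pi.single_apply, hne] using congrFun hij i
  have hdisj : ∀ i j, x + Pi.single i 1 ≠ x - Pi.single j 1 := fun i j hij => by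
    have := congrFun hij i
    simp only [Pi.add_apply, Pi.sub_apply, Pi.single_apply, if_true] at this
    split_ifs at this <;> omega
  let up : Finset (Fin k → ℤ) := Finset.univ.image fun i => x + Pi.single i 1
  let dn : Finset (Fin k → ℤ) := Finset.univ.image fun i => x - Pi.single i 1
  rw [finsum_mem_eq_sum_of_inter_support_eq (t := (insert x (up ∪ dn)).filter W0)]
  · rw [Finset.sum_filter, Finset.sum_insert, Finset.sum_union, if_pos hx, ← add_assoc,
      Finset.sum_image, Finset.sum_image]
    · congr 1
      · congr 1
        refine Finset.sum_congr rfl fun i _ => ?_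
        split_ifs with hw
        · exact hQ _ (hadd i) hw ⟨i, Or.inl rfl⟩
        · exact (hf _ hw).symm
      · refine Finset.sum_congr rfl fun i _ => ?_
        split_ifs with hw
        · exact hQ _ (hsub i) hw ⟨i, Or.inr rfl⟩
        · exact (hf _ hw).symm
    · exact fun i _ j _ hij => hinj (sub_right_injective hij)
    · exact fun i _ j _ hij => hinj (add_right_injective x hij)
    · simp only [up, dn, Finset.disjoint_left, Finset.mem_image, Finset.mem_univ, true_and,
        not_exists]
      rintro _ ⟨i, rfl⟩ j hj
      exact hdisj i j hj.symm
    · simp only [up, dn, Finset.mem_union, Finset.mem_image, Finset.mem_univ, true_and]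
      rintro (⟨i, hi⟩ | ⟨i, hi⟩)
      exacts [hadd i hi, hsub i hi]
  · ext z
    simp only [up, dn, Set.mem_inter_iff, Set.mem_ofPred_eq, Function.mem_support,
      Finset.coe_filter, Finset.mem_insert, Finset.mem_union, Finset.mem_image, Finset.mem_univ,
      true_and]
    refine and_congr_left fun hz => ⟨fun hw => ⟨?_, hw⟩, fun hw => hw.2⟩
    by_contra hn
    push Not at hn
    refine hz (hQ0 z hn.1 ?_)
    rintro ⟨i, hi | hi⟩
    exacts [hn.2.1 i hi.symm, hn.2.2 i hi.symm]

open Classical in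
lemma finsum_Qeven (m : ℕ) (q : ℕ → ℝ) (x : Fin (m + 1) → ℤ) (hx : W0 x)
    (S : (Fin (m + 1) → ℤ) → ℝ) (hS : ∀ z, W0 z → S z = SpEven (m + 1) q z)
    (hS0 : ∀ z, ¬ W0 z → S z = 0) :
    ∑ᶠ x' ∈ {x' : Fin (m + 1) → ℤ | W0 x'}, Qeven m q x x' =
      -(∑ i ∈ Finset.range (m + 1), (q i + (q i)⁻¹)) +
        (∑ i, S (x + Pi.single i 1) + ∑ i, S (x - Pi.single i 1)) / S x := by
  rw [finsum_mem_w0_step (Qeven m q x) (fun z => S z / S x) x hx (fun z hz => by simp [hS0 z hz])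
    (fun x' hne hw hstep => by simp [Qeven, hne, hstep, hw, hS, hx])
    (fun x' hne hstep => by simp only [Qeven, hne, hstep, if_false, false_and])]
  · simp only [Qeven, if_true, add_div, Finset.sum_div, add_assoc]

open Classical in
lemma finsum_Qodd (m : ℕ) (q : ℕ → ℝ) (x : Fin (m + 1) → ℤ) (hx : W0 x)
    (S : (Fin (m + 1) → ℤ) → ℝ) (hS : ∀ z, W0 z → S z = SpOdd (m + 1) q z)
    (hS0 : ∀ z, ¬ W0 z → S z = 0) :
    ∑ᶠ x' ∈ {x' : Fin (m + 1) → ℤ | W0 x'}, Qodd m q x x' =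
      -((∑ i ∈ Finset.range m, (q i + (q i)⁻¹)) +
        (q m)⁻¹ * (if 0 < x 0 then 1 else 0) + q m) +
        (∑ i, S (x + Pi.single i 1) + ∑ i, S (x - Pi.single i 1)) / S x := by
  rw [finsum_mem_w0_step (Qodd m q x) (fun z => S z / S x) x hx (fun z hz => by simp [hS0 z hz])
    (fun x' hne hw hstep => by simp [Qodd, hne, hstep, hw, hS, hx])
    (fun x' hne hstep => by simp only [Qodd, hne, hstep, if_false, false_and])]
  · simp only [Qodd, if_true, add_div, Finset.sum_div, add_assoc]

lemma IsSymp.le_of_top {n : ℕ} {p : ℕ → ℕ → ℤ} (h : IsSymp n p) {B : ℤ}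
    (hB : ∀ i < (n + 1) / 2, p n i ≤ B) {r : ℕ} (hr : 1 ≤ r) (hrn : r ≤ n) :
    ∀ i < (r + 1) / 2, p r i ≤ B := by
  induction hrn using Nat.decreasingInduction with
  | self => exact hB
  | of_succ r hlt ih =>
    intro i hi
    have ih := ih (by omega)
    rcases Nat.even_or_odd' r with ⟨k, rfl | rfl⟩
    · exact ((h.2.2.1 k (by omega) (by omega)) i (by omega)).2.trans (ih (i + 1) (by omega))
    · have := (h.2.1 (k + 1) (by omega) (by omega)).1 i (by omega)
      rw [show 2 * (k + 1) - 1 = 2 * k + 1 by omega] at this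
      exact this.trans (ih i (by omega))

lemma finite_isSymp_le (n : ℕ) (B : ℤ) :
    {p : ℕ → ℕ → ℤ | IsSymp n p ∧ ∀ i < (n + 1) / 2, p n i ≤ B}.Finite := by
  refine Set.Finite.of_injOn
    (f := fun (p : ℕ → ℕ → ℤ) (r i : Fin (n + 1)) => p r i)
    (t := Set.Icc 0 fun _ _ => max B 0) ?_ ?_ (Set.finite_Icc _ _)
  · rintro p ⟨hp, hB⟩
    have key : ∀ r i, 0 ≤ p r i ∧ p r i ≤ max B 0 := fun r i => by
      by_cases hr : r = 0 ∨ n < r ∨ (r + 1) / 2 ≤ i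
      · rw [hp.2.2.2 r i hr]
        exact ⟨le_rfl, le_max_right _ _⟩
      · push Not at hr
        exact ⟨hp.1 r i (by omega) hr.2.1 hr.2.2,
          (hp.le_of_top hB (by omega) hr.2.1 i hr.2.2).trans (le_max_left _ _)⟩
    exact ⟨fun r i => (key r i).1, fun r i => (key r i).2⟩
  · rintro p ⟨hp, -⟩ p' ⟨hp', -⟩ heq
    funext r i
    by_cases hr : r = 0 ∨ n < r ∨ (r + 1) / 2 ≤ i
    · rw [hp.2.2.2 r i hr, hp'.2.2.2 r i hr]
    · push Not at hr
      exact congrFun (congrFun heq ⟨r, by omega⟩) ⟨i, by omega⟩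

lemma finite_isSymp_top {n k : ℕ} (hk : (n + 1) / 2 ≤ k) (z : Fin k → ℤ) :
    {p : ℕ → ℕ → ℤ | IsSymp n p ∧ ∀ i : Fin k, p n i = z i}.Finite := by
  obtain ⟨B, hB⟩ := (Set.finite_range z).bddAbove
  refine (finite_isSymp_le n B).subset fun p hp => ⟨hp.1, fun i hi => ?_⟩
  rw [hp.2 ⟨i, by omega⟩]
  exact hB ⟨_, rfl⟩

lemma wSymp_pos {q : ℕ → ℝ} (hq : ∀ i, 0 < q i) (n : ℕ) (p : ℕ → ℕ → ℤ) : 0 < wSymp n q p :=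
  Finset.prod_pos fun _ _ => zpow_pos (hq _) _

lemma exists_isSymp_even {k : ℕ} {x : Fin k → ℤ} (hx : W0 x) :
    ∃ p, IsSymp (2 * k) p ∧ ∀ i : Fin k, p (2 * k) i = x i := by
  let X : ℕ → ℤ := fun j => if h : j < k then x ⟨j, h⟩ else 0
  have hX0 : ∀ j, 0 ≤ X j := fun j => by
    simp only [X]
    split_ifs with h
    exacts [hx.2 _, le_rfl]
  have hXm : ∀ i j, i ≤ j → j < k → X i ≤ X j := fun i j hij hj => by
    simp only [X, hj, hij.trans_lt hj, dif_pos]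
    exact hx.1 (Fin.le_def.2 hij)
  let p : ℕ → ℕ → ℤ := fun r i =>
    if r = 0 ∨ 2 * k < r ∨ (r + 1) / 2 ≤ i then 0 else X (i + k - (r + 1) / 2)
  have hp : ∀ r i, 1 ≤ r → r ≤ 2 * k → i < (r + 1) / 2 → p r i = X (i + k - (r + 1) / 2) :=
    fun r i h1 h2 h3 => if_neg (by omega)
  refine ⟨p, ⟨fun r i h1 h2 h3 => ?_, fun c h1 h2 => ⟨fun j hj => ?_, fun j hj => ?_⟩,
    fun c h1 h2 j hj => ⟨?_, ?_⟩, fun r i h => if_pos h⟩, fun i => ?_⟩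
  · rw [hp r i h1 h2 h3]
    exact hX0 _
  iterate 4
    · rw [hp _ _ (by omega) (by omega) (by omega), hp _ _ (by omega) (by omega) (by omega)]
      exact hXm _ _ (by omega) (by omega)
  · have hi := i.2
    rw [hp _ _ (by omega) le_rfl (by omega), show (i : ℕ) + k - (2 * k + 1) / 2 = i by omega]
    exact dif_pos hi

lemma SpEven_pos {k : ℕ} {q : ℕ → ℝ} (hq : ∀ i, 0 < q i) {x : Fin k → ℤ} (hx : W0 x) :
    0 < SpEven k q x := by
  have hfin := finite_isSymp_top (n := 2 * k) (k := k) (by omega) x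
  rw [SpEven, finsum_mem_eq_finite_toFinset_sum _ hfin]
  obtain ⟨p, hp⟩ := exists_isSymp_even hx
  exact Finset.sum_pos (fun _ _ => wSymp_pos hq _ _) ⟨p, hfin.mem_toFinset.2 hp⟩

/-- Erase the rows above the `n`-th one. -/
def truncRows (n : ℕ) (p : ℕ → ℕ → ℤ) (r i : ℕ) : ℤ := if r ≤ n then p r i else 0

lemma IsSymp.truncRows {n : ℕ} {p : ℕ → ℕ → ℤ} (h : IsSymp (n + 1) p) :
    IsSymp n (truncRows n p) := by
  obtain ⟨h1, h2, h3, h4⟩ := h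
  refine ⟨fun r i hr hrn hi => ?_, fun k hk hkn => ?_, fun k hk hkn => ?_, fun r i hr => ?_⟩
  · simpa only [_root_.truncRows, if_pos hrn] using h1 r i hr (by omega) hi
  · simpa only [_root_.truncRows, if_pos hkn, if_pos (show 2 * k - 1 ≤ n by omega)]
      using h2 k hk (by omega)
  · simpa only [_root_.truncRows, if_pos hkn, if_pos (show 2 * k ≤ n by omega)]
      using h3 k hk (by omega)
  · unfold _root_.truncRows
    split_ifs with hrn
    · exact h4 r i (by omega)
    · rfl

lemma wSymp_truncRows (n : ℕ) (q : ℕ → ℝ) (p : ℕ → ℕ → ℤ) :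
    wSymp n q (truncRows n p) = wSymp n q p := by
  have hrow : ∀ r ≤ n, rowSumS (truncRows n p) r = rowSumS p r := fun r hr =>
    Finset.sum_congr rfl fun i _ => if_pos hr
  refine Finset.prod_congr rfl fun r hr => ?_
  have hr := (Finset.mem_Icc.1 hr).2
  rw [hrow r hr, hrow (r - 1) (by omega)]

lemma rowSumS_eq_vsum {r k : ℕ} (hk : (r + 1) / 2 = k) {p : ℕ → ℕ → ℤ} {z : Fin k → ℤ}
    (h : ∀ i : Fin k, p r i = z i) : rowSumS p r = vsum z := by
  rw [rowSumS, hk, Finset.sum_range]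
  exact Finset.sum_congr rfl fun i _ => h i

lemma wSymp_odd (k : ℕ) (q : ℕ → ℝ) (p : ℕ → ℕ → ℤ) {x : Fin k → ℤ} {y : Fin (k + 1) → ℤ}
    (hx : ∀ i : Fin k, p (2 * k) i = x i) (hy : ∀ i : Fin (k + 1), p (2 * k + 1) i = y i) :
    wSymp (2 * k + 1) q p = wSymp (2 * k) q (truncRows (2 * k) p) * q k ^ (vsum y - vsum x) := by
  rw [wSymp_truncRows, wSymp, Finset.prod_Icc_succ_top (by omega), ← wSymp,
    rowSumS_eq_vsum (by omega) hy, Nat.add_sub_cancel, rowSumS_eq_vsum (by omega) hx,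
    show (2 * k + 1 + 1) / 2 - 1 = k by omega, if_pos (by omega), one_mul]

/-- Erasing the top odd row `y` is a bijection onto the even patterns with top row `x ⪯ y`. -/
lemma bijOn_truncRows {k : ℕ} {x : Fin k → ℤ} {y : Fin (k + 1) → ℤ} (hy : W0 y)
    (hxy : Interlace x y) :
    Set.BijOn (truncRows (2 * k))
      {p | (IsSymp (2 * k + 1) p ∧ ∀ i : Fin (k + 1), p (2 * k + 1) i = y i) ∧
        ∀ i : Fin k, p (2 * k) i = x i}
      {p | IsSymp (2 * k) p ∧ ∀ i : Fin k, p (2 * k) i = x i} := by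
  refine ⟨?_, ?_, ?_⟩
  · rintro p ⟨⟨hp, -⟩, hpx⟩
    exact ⟨hp.truncRows, fun i => by simpa [truncRows] using hpx i⟩
  · rintro p ⟨⟨hp, hpy⟩, -⟩ p' ⟨⟨hp', hpy'⟩, -⟩ heq
    funext r i
    by_cases hr : r = 0 ∨ 2 * k + 1 < r ∨ (r + 1) / 2 ≤ i
    · rw [hp.2.2.2 r i hr, hp'.2.2.2 r i hr]
    · rcases Nat.lt_or_ge (2 * k) r with h | h
      · obtain rfl : r = 2 * k + 1 := by omega
        exact (hpy ⟨i, by omega⟩).trans (hpy' ⟨i, by omega⟩).symm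
      · simpa [truncRows, h] using congrFun (congrFun heq r) i
  · rintro p ⟨⟨h1, h2, h3, h4⟩, hpx⟩
    let p' : ℕ → ℕ → ℤ := fun r i =>
      if r = 2 * k + 1 then (if h : i < k + 1 then y ⟨i, h⟩ else 0) else p r i
    have htop : ∀ i (h : i < k + 1), p' (2 * k + 1) i = y ⟨i, h⟩ := fun i h => by
      simp only [p', if_true, dif_pos h]
    have hlow : ∀ r i, r ≠ 2 * k + 1 → p' r i = p r i := fun r i h => if_neg h
    refine ⟨p', ⟨⟨⟨fun r i hr hrn hi => ?_, fun c hc hcn => ?_, fun c hc hcn j hj => ?_,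
      fun r i hr => ?_⟩, fun i => htop i i.2⟩, fun i => ?_⟩, ?_⟩
    · by_cases h : r = 2 * k + 1
      · subst h
        rw [htop i (by omega)]
        exact hy.2 _
      · rw [hlow r i h]
        exact h1 r i hr (by omega) hi
    · simpa only [hlow _ _ (show 2 * c ≠ 2 * k + 1 by omega),
        hlow _ _ (show 2 * c - 1 ≠ 2 * k + 1 by omega)] using h2 c hc (by omega)
    · rw [hlow (2 * c) _ (by omega)]
      by_cases h : c = k
      · subst h
        rw [htop j (by omega), htop (j + 1) (by omega), hpx ⟨j, hj⟩]
        exact hxy ⟨j, hj⟩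
      · rw [hlow _ _ (by omega), hlow _ _ (by omega)]
        exact h3 c hc (by omega) j hj
    · by_cases h : r = 2 * k + 1
      · subst h
        simp only [p', if_true]
        exact dif_neg (by omega)
      · rw [hlow r i h]
        exact h4 r i (by omega)
    · rw [hlow _ _ (by omega), hpx]
    · funext r i
      unfold truncRows
      split_ifs with h
      · exact hlow r i (by omega)
      · exact (h4 r i (by omega)).symm

lemma finsum_wSymp_odd_fiber {k : ℕ} (q : ℕ → ℝ) {x : Fin k → ℤ} {y : Fin (k + 1) → ℤ}
    (hy : W0 y) (hxy : Interlace x y) :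
    ∑ᶠ p ∈ {p : ℕ → ℕ → ℤ | (IsSymp (2 * k + 1) p ∧
        ∀ i : Fin (k + 1), p (2 * k + 1) i = y i) ∧ ∀ i : Fin k, p (2 * k) i = x i},
      wSymp (2 * k + 1) q p = SpEven k q x * q k ^ (vsum y - vsum x) := by
  rw [SpEven, finsum_mem_mul]
  exact finsum_mem_eq_of_bijOn _ (bijOn_truncRows hy hxy) fun p hp => wSymp_odd k q p hp.2 hp.1.2

/-- Branching rule from odd to even symplectic Schur functions. -/
lemma SpOdd_eq_interlaceSum {k : ℕ} (q : ℕ → ℝ) {S : (Fin k → ℤ) → ℝ}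
    (hS : ∀ x, W0 x → S x = SpEven k q x) {y : Fin (k + 1) → ℤ} (hy : W0 y) :
    SpOdd (k + 1) q y = interlaceSum (q k) S y := by
  classical
  have hodd : 2 * (k + 1) - 1 = 2 * k + 1 := by omega
  have hunion : {p : ℕ → ℕ → ℤ | IsSymp (2 * k + 1) p ∧
        ∀ i : Fin (k + 1), p (2 * k + 1) i = y i} =
      ⋃ x ∈ {x : Fin k → ℤ | Interlace x y}, {p | (IsSymp (2 * k + 1) p ∧
        ∀ i : Fin (k + 1), p (2 * k + 1) i = y i) ∧ ∀ i : Fin k, p (2 * k) i = x i} := by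
    ext p
    simp only [Set.mem_iUnion, Set.mem_ofPred_eq, exists_prop]
    refine ⟨fun hp => ⟨fun i => p (2 * k) i, fun i => ?_, hp, fun i => rfl⟩,
      fun ⟨x, _, hp, _⟩ => hp⟩
    rw [← hp.2, ← hp.2]
    exact hp.1.2.2.1 k i.pos le_rfl i i.2
  rw [SpOdd, hodd, hunion, finsum_mem_biUnion, interlaceSum]
  · refine finsum_congr fun x => ?_
    by_cases hxy : Interlace x y
    · have hi : interlaceInd x y = 1 := if_pos ⟨hxy, hy.2 0⟩
      rw [finsum_eq_if, if_pos (show x ∈ {x | Interlace x y} from hxy),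
        finsum_wSymp_odd_fiber q hy hxy, hi, mul_one,
        hS x (hxy.w0 hy)]
    · rw [finsum_eq_if, if_neg (show x ∉ {x | Interlace x y} from hxy),
        interlaceInd_of_not hxy, mul_zero]
  · intro x _ x' _ hne
    refine Set.disjoint_left.2 fun p hp hp' => hne (funext fun i => ?_)
    exact (hp.2 i).symm.trans (hp'.2 i)
  · exact finite_interlace y
  · exact fun x _ => (finite_isSymp_top (n := 2 * k + 1) (by omega) y).subset fun p hp => hp.1

lemma interlaceSum_pos {n : ℕ} {a : ℝ} (ha : 0 < a) {S : (Fin n → ℤ) → ℝ}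
    (hS : ∀ x, W0 x → 0 < S x) {y : Fin (n + 1) → ℤ} (hy : W0 y) : 0 < interlaceSum a S y := by
  have hterm : ∀ x, Interlace x y → 0 < S x * a ^ (vsum y - vsum x) * interlaceInd x y :=
    fun x hx => by
      rw [interlaceInd, if_pos ⟨hx, hy.2 0⟩, mul_one]
      exact mul_pos (hS x (hx.w0 hy)) (zpow_pos ha _)
  refine finsum_pos (fun x => ?_) ⟨fun i => y i.succ, hterm _ fun i =>
    ⟨hy.1 (Fin.castSucc_lt_succ (i := i)).le, le_rfl⟩⟩ (hasFiniteSupport_mul_interlaceInd _ _)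
  by_cases hx : Interlace x y
  · exact (hterm x hx).le
  · simp [interlaceInd_of_not hx]

/-- Conservativity propagates from even to odd rows (here `n = m+1`): if all rows of
`Q_{2n}` (built from `q = (q_1,…,q_n)`) sum to zero over `W₀^n`, then all rows of
`Q_{2n+1}` (built from `q̃ = (q_1,…,q_{n+1})`) sum to zero over `W₀^{n+1}`. -/
theorem wall_conservative_even_to_odd (m : ℕ) (q : ℕ → ℝ)
    (hq : ∀ i, 0 < q i ∧ q i < 1)
    (h : ∀ x : Fin (m + 1) → ℤ, W0 x →
      ∑ᶠ x' ∈ {x' : Fin (m + 1) → ℤ | W0 x'}, Qeven m q x x' = 0) :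
    ∀ y : Fin (m + 2) → ℤ, W0 y →
      ∑ᶠ y' ∈ {y' : Fin (m + 2) → ℤ | W0 y'}, Qodd (m + 1) q y y' = 0 := by
  classical
  intro y hy
  have hq0 : ∀ i, 0 < q i := fun i => (hq i).1
  let S : (Fin (m + 1) → ℤ) → ℝ := fun x => if W0 x then SpEven (m + 1) q x else 0
  have hS : ∀ x, W0 x → S x = SpEven (m + 1) q x := fun x hx => if_pos hx
  have hS0 : ∀ x, ¬ W0 x → S x = 0 := fun x hx => if_neg hx
  have hSpos : ∀ x, W0 x → 0 < S x := fun x hx => (hS x hx).symm ▸ SpEven_pos hq0 hx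
  have heigen : ∀ x, W0 x → ∑ i, S (x + Pi.single i 1) + ∑ i, S (x - Pi.single i 1) =
      (∑ i ∈ Finset.range (m + 1), (q i + (q i)⁻¹)) * S x := fun x hx => by
    have hsum := h x hx
    rw [finsum_Qeven m q x hx S hS hS0, neg_add_eq_zero, eq_comm] at hsum
    exact (div_eq_iff (hSpos x hx).ne').1 hsum
  have hodd := interlaceSum_eigen (hq0 (m + 1)).ne' hS0 heigen hy
  rw [finsum_Qodd (m + 1) q y hy (interlaceSum (q (m + 1)) S)
    (fun z hz => (SpOdd_eq_interlaceSum q hS hz).symm)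
    (fun z hz => interlaceSum_of_not_w0 _ _ hz), hodd,
    mul_div_cancel_right₀ _ (interlaceSum_pos (hq0 (m + 1)) hSpos hy).ne']
  convert neg_add_cancel _

end
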